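/- arXiv:2210.09247 — 3 statements merged into one kernel-verified Lean document; each statement's English description precedes it below -/
import Mathlib

section
/- The parameterization associated with a given flat output is unique: let f be flat along a trajectory (x̄,ū) with flat output Φ (window lengths q₁,q₂), and suppose F : ℤ × V → ℝ^n × ℝ^m and F' : ℤ × V' → ℝ^n × ℝ^m are two parameterizations with the same window lengths r₁,r₂ that both satisfy conditions (F1)–(F4) with this Φ. Then for every k ∈ ℤ, F(k,·) and F'(k,·) coincide on a neighborhood of the reference window W_k^{r₁,r₂}(ȳ), where ȳ(k) := Φ(k, W_k^{q₁,q₂}(x̄,ū)). -/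
open Filter Topology

noncomputable section

/-- `Vec d` is the state/input space `ℝ^d`. -/
abbrev Vec (d : ℕ) : Type := Fin d → ℝ

/-- A trajectory of the time-varying discrete-time system `x⁺ = f(k,x,u)`. -/
def IsTrajectory (n m : ℕ) (f : ℤ → Vec n → Vec m → Vec n)
    (x : ℤ → Vec n) (u : ℤ → Vec m) : Prop :=
  ∀ k : ℤ, x (k + 1) = f k (x k) (u k)

/-- A trajectory of the linearization of `f` along the trajectory `(xb, ub)`:
`Δx(k+1) = A(k) Δx(k) + B(k) Δu(k)` with `A(k) = D_x f(k, xb k, ub k)`,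
`B(k) = D_u f(k, xb k, ub k)`. -/
def IsLinTrajectory (n m : ℕ) (f : ℤ → Vec n → Vec m → Vec n)
    (xb : ℤ → Vec n) (ub : ℤ → Vec m)
    (Δx : ℤ → Vec n) (Δu : ℤ → Vec m) : Prop :=
  ∀ k : ℤ, Δx (k + 1) =
    fderiv ℝ (fun x => f k x (ub k)) (xb k) (Δx k) +
    fderiv ℝ (fun u => f k (xb k) u) (ub k) (Δu k)

/-- The window `W_k^{q₁,q₂}(x,u) = ((x(k-q₁),u(k-q₁)),…,(x(k+q₂),u(k+q₂)))`. -/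
def pairWin (n m q₁ q₂ : ℕ) (x : ℤ → Vec n) (u : ℤ → Vec m) (k : ℤ) :
    Fin (q₁ + q₂ + 1) → Vec n × Vec m :=
  fun i => (x (k - q₁ + (i : ℕ)), u (k - q₁ + (i : ℕ)))

/-- The window `W_k^{r₁,r₂}(y) = (y(k-r₁),…,y(k+r₂))`. -/
def seqWin (m r₁ r₂ : ℕ) (y : ℤ → Vec m) (k : ℤ) :
    Fin (r₁ + r₂ + 1) → Vec m :=
  fun i => y (k - r₁ + (i : ℕ))

/-- The data `(q₁,q₂,r₁,r₂,U,V,Φ,F)` witnessing flatness of the system `f`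
along the trajectory `(xb, ub)`, conditions (F1)–(F4). -/
structure FlatData (n m : ℕ) (f : ℤ → Vec n → Vec m → Vec n)
    (xb : ℤ → Vec n) (ub : ℤ → Vec m) (q₁ q₂ r₁ r₂ : ℕ)
    (U : Set (Fin (q₁ + q₂ + 1) → Vec n × Vec m))
    (V : Set (Fin (r₁ + r₂ + 1) → Vec m))
    (Φ : ℤ → (Fin (q₁ + q₂ + 1) → Vec n × Vec m) → Vec m)
    (F : ℤ → (Fin (r₁ + r₂ + 1) → Vec m) → Vec n × Vec m) : Prop where
  traj : IsTrajectory n m f xb ub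
  openU : IsOpen U
  openV : IsOpen V
  smoothPhi : ∀ k : ℤ, ContDiffOn ℝ (⊤ : ℕ∞) (Φ k) U
  smoothF : ∀ k : ℤ, ContDiffOn ℝ (⊤ : ℕ∞) (F k) V
  /-- (F1), first half: the reference windows lie in `U`. -/
  memU : ∀ k : ℤ, pairWin n m q₁ q₂ xb ub k ∈ U
  /-- (F1), second half: the windows of the reference flat output lie in `V`. -/
  memV : ∀ k : ℤ,
    seqWin m r₁ r₂ (fun j => Φ j (pairWin n m q₁ q₂ xb ub j)) k ∈ V
  /-- (F2): the parameterization satisfies the system equations. -/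
  F2 : ∀ (k : ℤ) (y : ℤ → Vec m),
    seqWin m r₁ r₂ y k ∈ V → seqWin m r₁ r₂ y (k + 1) ∈ V →
    (F (k + 1) (seqWin m r₁ r₂ y (k + 1))).1 =
      f k (F k (seqWin m r₁ r₂ y k)).1 (F k (seqWin m r₁ r₂ y k)).2
  /-- (F3): `Φ` is a left inverse of the parameterization. -/
  F3 : ∀ (k : ℤ) (y : ℤ → Vec m),
    (∀ j : ℤ, k - q₁ ≤ j → j ≤ k + q₂ → seqWin m r₁ r₂ y j ∈ V) →
    (fun i : Fin (q₁ + q₂ + 1) =>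
        F (k - q₁ + (i : ℕ)) (seqWin m r₁ r₂ y (k - q₁ + (i : ℕ)))) ∈ U →
    Φ k (fun i : Fin (q₁ + q₂ + 1) =>
        F (k - q₁ + (i : ℕ)) (seqWin m r₁ r₂ y (k - q₁ + (i : ℕ)))) = y k
  /-- (F4): `F` recovers a solution from the values of its flat output. -/
  F4 : ∀ (k : ℤ) (x : ℤ → Vec n) (u : ℤ → Vec m),
    (∀ j : ℤ, k - r₁ - q₁ ≤ j → j < k + r₂ + q₂ → x (j + 1) = f j (x j) (u j)) →
    (∀ j : ℤ, k - r₁ ≤ j → j ≤ k + r₂ → pairWin n m q₁ q₂ x u j ∈ U) →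
    seqWin m r₁ r₂ (fun j => Φ j (pairWin n m q₁ q₂ x u j)) k ∈ V →
    (x k, u k) = F k (seqWin m r₁ r₂ (fun j => Φ j (pairWin n m q₁ q₂ x u j)) k)

/-- The reference flat-output trajectory `ȳ(k) = Φ(k, W_k^{q₁,q₂}(x̄,ū))`. -/
def refOut (n m q₁ q₂ : ℕ) (Φ : ℤ → (Fin (q₁ + q₂ + 1) → Vec n × Vec m) → Vec m)
    (xb : ℤ → Vec n) (ub : ℤ → Vec m) : ℤ → Vec m :=
  fun k => Φ k (pairWin n m q₁ q₂ xb ub k)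

/-- The system `f` is flat along the trajectory `(xb, ub)`. -/
def IsFlatAlong (n m : ℕ) (f : ℤ → Vec n → Vec m → Vec n)
    (xb : ℤ → Vec n) (ub : ℤ → Vec m) : Prop :=
  ∃ (q₁ q₂ r₁ r₂ : ℕ) (U : Set (Fin (q₁ + q₂ + 1) → Vec n × Vec m))
    (V : Set (Fin (r₁ + r₂ + 1) → Vec m))
    (Φ : ℤ → (Fin (q₁ + q₂ + 1) → Vec n × Vec m) → Vec m)
    (F : ℤ → (Fin (r₁ + r₂ + 1) → Vec m) → Vec n × Vec m),
    FlatData n m f xb ub q₁ q₂ r₁ r₂ U V Φ F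

/-- `f` is submersive along `(xb, ub)`: the Jacobian of `f(k,·,·)` at
`(xb k, ub k)` is surjective for every `k`. -/
def IsSubmersiveAlong (n m : ℕ) (f : ℤ → Vec n → Vec m → Vec n)
    (xb : ℤ → Vec n) (ub : ℤ → Vec m) : Prop :=
  ∀ k : ℤ, Function.Surjective
    ⇑(fderiv ℝ (Function.uncurry (f k)) (xb k, ub k))


/-- The sequence `y` with its window at `k` replaced by `p`. -/
def replaceWin (m r₁ r₂ : ℕ) (y : ℤ → Vec m) (k : ℤ) (p : Fin (r₁ + r₂ + 1) → Vec m) :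
    ℤ → Vec m :=
  fun j => if h : (j - (k - r₁)).toNat < r₁ + r₂ + 1 ∧ k - r₁ ≤ j then
    p ⟨(j - (k - r₁)).toNat, h.1⟩ else y j

theorem seqWin_replaceWin (m r₁ r₂ : ℕ) (y : ℤ → Vec m) (k : ℤ)
    (p : Fin (r₁ + r₂ + 1) → Vec m) :
    seqWin m r₁ r₂ (replaceWin m r₁ r₂ y k p) k = p := by
  funext i
  have hi := i.isLt
  have h : (k - r₁ + (i : ℕ) - (k - r₁)).toNat = (i : ℕ) := by omega
  unfold seqWin replaceWin
  rw [dif_pos ⟨by omega, by omega⟩]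
  congr 1
  exact Fin.ext h

theorem replaceWin_seqWin (m r₁ r₂ : ℕ) (y : ℤ → Vec m) (k : ℤ) :
    replaceWin m r₁ r₂ y k (seqWin m r₁ r₂ y k) = y := by
  funext j
  unfold replaceWin seqWin
  split_ifs with h
  · congr 1
    have := h.2
    simp only
    omega
  · rfl

theorem continuous_seqWin_replaceWin (m r₁ r₂ : ℕ) (y : ℤ → Vec m) (k j : ℤ) :
    Continuous fun p => seqWin m r₁ r₂ (replaceWin m r₁ r₂ y k p) j := by
  refine continuous_pi fun i => ?_
  unfold seqWin replaceWin
  split_ifs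
  · exact continuous_apply _
  · exact continuous_const

namespace FlatData

variable {n m : ℕ} {f : ℤ → Vec n → Vec m → Vec n} {xb : ℤ → Vec n} {ub : ℤ → Vec m}
  {q₁ q₂ r₁ r₂ : ℕ} {U : Set (Fin (q₁ + q₂ + 1) → Vec n × Vec m)}
  {V : Set (Fin (r₁ + r₂ + 1) → Vec m)}
  {Φ : ℤ → (Fin (q₁ + q₂ + 1) → Vec n × Vec m) → Vec m}
  {F : ℤ → (Fin (r₁ + r₂ + 1) → Vec m) → Vec n × Vec m}

/-- The parameterization sends the reference flat output to the reference trajectory. -/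
theorem apply_refOut (h : FlatData n m f xb ub q₁ q₂ r₁ r₂ U V Φ F) (k : ℤ) :
    F k (seqWin m r₁ r₂ (refOut n m q₁ q₂ Φ xb ub) k) = (xb k, ub k) :=
  (h.F4 k xb ub (fun j _ _ => h.traj j) (fun j _ _ => h.memU j) (h.memV k)).symm

/-- Near the reference, replacing one window of the flat output keeps every window in `V`. -/
theorem eventually_seqWin_mem (h : FlatData n m f xb ub q₁ q₂ r₁ r₂ U V Φ F) (k j : ℤ) :
    ∀ᶠ p in 𝓝 (seqWin m r₁ r₂ (refOut n m q₁ q₂ Φ xb ub) k),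
      seqWin m r₁ r₂ (replaceWin m r₁ r₂ (refOut n m q₁ q₂ Φ xb ub) k p) j ∈ V := by
  refine (continuous_seqWin_replaceWin m r₁ r₂ _ k j).continuousAt.eventually_mem ?_
  rw [replaceWin_seqWin]
  exact h.openV.mem_nhds (h.memV j)

/-- Near the reference, the trajectory generated by the modified flat output has its windows
in `U`. -/
theorem eventually_pairWin_mem (h : FlatData n m f xb ub q₁ q₂ r₁ r₂ U V Φ F) (k j : ℤ) :
    ∀ᶠ p in 𝓝 (seqWin m r₁ r₂ (refOut n m q₁ q₂ Φ xb ub) k),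
      (fun i : Fin (q₁ + q₂ + 1) => F (j - q₁ + (i : ℕ)) (seqWin m r₁ r₂
        (replaceWin m r₁ r₂ (refOut n m q₁ q₂ Φ xb ub) k p) (j - q₁ + (i : ℕ)))) ∈ U := by
  refine ContinuousAt.eventually_mem (continuousAt_pi.2 fun i => ?_) ?_
  · refine ContinuousAt.comp (g := F (j - q₁ + (i : ℕ))) ?_
      (continuous_seqWin_replaceWin m r₁ r₂ _ k _).continuousAt
    rw [replaceWin_seqWin]
    exact (h.smoothF _).continuousOn.continuousAt (h.openV.mem_nhds (h.memV _))
  · rw [replaceWin_seqWin]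
    simp only [h.apply_refOut]
    exact h.openU.mem_nhds (h.memU j)

end FlatData

/-- The parameterization associated with a given flat output
is unique: two parameterizations satisfying (F1)–(F4) with the same flat
output `Φ` coincide near the reference window, for every `k`. -/
theorem parameterization_unique
    (n m : ℕ) (f : ℤ → Vec n → Vec m → Vec n)
    (hf : ∀ k : ℤ, ContDiff ℝ (⊤ : ℕ∞) (Function.uncurry (f k)))
    (xb : ℤ → Vec n) (ub : ℤ → Vec m)
    (q₁ q₂ r₁ r₂ : ℕ)
    (U : Set (Fin (q₁ + q₂ + 1) → Vec n × Vec m))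
    (V V' : Set (Fin (r₁ + r₂ + 1) → Vec m))
    (Φ : ℤ → (Fin (q₁ + q₂ + 1) → Vec n × Vec m) → Vec m)
    (F F' : ℤ → (Fin (r₁ + r₂ + 1) → Vec m) → Vec n × Vec m)
    (hdata : FlatData n m f xb ub q₁ q₂ r₁ r₂ U V Φ F)
    (hdata' : FlatData n m f xb ub q₁ q₂ r₁ r₂ U V' Φ F') :
    ∀ k : ℤ, ∀ᶠ p in 𝓝 (seqWin m r₁ r₂ (refOut n m q₁ q₂ Φ xb ub) k),
      F k p = F' k p := by
  intro k
  have hV : ∀ᶠ p in 𝓝 (seqWin m r₁ r₂ (refOut n m q₁ q₂ Φ xb ub) k),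
      ∀ j ∈ Set.Icc (k - r₁ - q₁) (k + r₂ + q₂),
        seqWin m r₁ r₂ (replaceWin m r₁ r₂ (refOut n m q₁ q₂ Φ xb ub) k p) j ∈ V :=
    (eventually_all_finite (Set.finite_Icc _ _)).2 fun j _ => hdata.eventually_seqWin_mem k j
  have hU := (eventually_all_finite (Set.finite_Icc (k - (r₁ : ℤ)) (k + r₂))).2
    fun j _ => hdata.eventually_pairWin_mem k j
  filter_upwards [hV, hU, hdata'.eventually_seqWin_mem k k] with p hpV hpU hpV'
  set y := replaceWin m r₁ r₂ (refOut n m q₁ q₂ Φ xb ub) k p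
  have hy : seqWin m r₁ r₂ y k = p := seqWin_replaceWin m r₁ r₂ _ k p
  let x : ℤ → Vec n := fun j => (F j (seqWin m r₁ r₂ y j)).1
  let u : ℤ → Vec m := fun j => (F j (seqWin m r₁ r₂ y j)).2
  have hout : seqWin m r₁ r₂ (fun j => Φ j (pairWin n m q₁ q₂ x u j)) k =
      seqWin m r₁ r₂ y k := by
    funext i
    have hi := i.isLt
    exact hdata.F3 _ y (fun j h₁ h₂ => hpV j ⟨by omega, by omega⟩)
      (hpU _ ⟨by omega, by omega⟩)
  have hF' := hdata'.F4 k x u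
    (fun j h₁ h₂ => hdata.F2 j y (hpV j ⟨h₁, h₂.le⟩) (hpV (j + 1) ⟨by omega, by omega⟩))
    (fun j h₁ h₂ => hpU j ⟨h₁, h₂⟩) (by rwa [hout])
  rw [hout, hy] at hF'
  rw [← hF', ← hy]

end
end

section
/- The linearized parameterization satisfies the linearized system equations identically: suppose F parameterizes the trajectories of f by arbitrary sequences. Then for every sequence y : ℤ → ℝ^m and every sequence Δy : ℤ → ℝ^m, defining the trajectory x(k) := F_x(k, y(k), …, y(k+R)), u(k) := F_u(k, y(k), …, y(k+R)), and defining Δx(k) := D F_x(k,·)(y(k),…,y(k+R))[(Δy(k),…,Δy(k+R))] and Δu(k) := D F_u(k,·)(y(k),…,y(k+R))[(Δy(k),…,Δy(k+R))] (Fréchet derivatives applied to the Δy-window), the pair (Δx, Δu) is a trajectory of the linearization of f along (x,u): Δx(k+1) = D_x f(k, x(k), u(k)) Δx(k) + D_u f(k, x(k), u(k)) Δu(k) for all k ∈ ℤ. -/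
noncomputable section

/-- The forward window `(y(k), y(k+1), …, y(k+R))` of a sequence. -/
def fwdWin (m R : ℕ) (y : ℤ → Vec m) (k : ℤ) : Fin (R + 1) → Vec m :=
  fun i => y (k + (i : ℕ))

/-- `F = (F_x, F_u)` parameterizes the trajectories of `f` by arbitrary
sequences: `F(k,·)` is `C^∞` for every `k`, and for every sequence
`y : ℤ → ℝ^m` the pair `x(k) = F_x(k, y(k),…,y(k+R))`,
`u(k) = F_u(k, y(k),…,y(k+R))` is a trajectory of `f`. -/
def Parameterizes (n m R : ℕ) (f : ℤ → Vec n → Vec m → Vec n)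
    (F : ℤ → (Fin (R + 1) → Vec m) → Vec n × Vec m) : Prop :=
  (∀ k : ℤ, ContDiff ℝ (⊤ : ℕ∞) (F k)) ∧
  ∀ y : ℤ → Vec m,
    IsTrajectory n m f (fun k => (F k (fwdWin m R y k)).1)
      (fun k => (F k (fwdWin m R y k)).2)


/-- The total derivative of a differentiable two-variable map is the sum of its partial
derivatives. -/
theorem fderiv_uncurry_apply {E F G : Type*} [NormedAddCommGroup E] [NormedSpace ℝ E]
    [NormedAddCommGroup F] [NormedSpace ℝ F] [NormedAddCommGroup G] [NormedSpace ℝ G]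
    {g : E → F → G} {a : E} {b : F} (hg : DifferentiableAt ℝ (Function.uncurry g) (a, b))
    (v : E) (w : F) :
    fderiv ℝ (Function.uncurry g) (a, b) (v, w) =
      fderiv ℝ (fun a' => g a' b) a v + fderiv ℝ (fun b' => g a b') b w := by
  have h₁ :=
    HasFDerivAt.comp (g := Function.uncurry g) a hg.hasFDerivAt
      (hasFDerivAt_prodMk_left (𝕜 := ℝ) a b)
  have h₂ :=
    HasFDerivAt.comp (g := Function.uncurry g) b hg.hasFDerivAt
      (hasFDerivAt_prodMk_right (𝕜 := ℝ) a b)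
  change _ = fderiv ℝ (Function.uncurry g ∘ fun a' => (a', b)) a v +
    fderiv ℝ (Function.uncurry g ∘ fun b' => (a, b')) b w
  rw [h₁.fderiv, h₂.fderiv]
  simp [← map_add]

/-- The linearized parameterization satisfies the linearized
system equations identically: for any sequences `y, Δy`, the sequences
`Δx(k) = D F_x(k,·)[W_k(Δy)]`, `Δu(k) = D F_u(k,·)[W_k(Δy)]` (derivatives
taken at `W_k(y)`) form a trajectory of the linearization of `f` along the
trajectory generated by `y`. -/
theorem linearized_parameterization_satisfies_linearized_system
    (n m R : ℕ) (f : ℤ → Vec n → Vec m → Vec n)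
    (hf : ∀ k : ℤ, ContDiff ℝ (⊤ : ℕ∞) (Function.uncurry (f k)))
    (F : ℤ → (Fin (R + 1) → Vec m) → Vec n × Vec m)
    (hF : Parameterizes n m R f F) :
    ∀ (y Δy : ℤ → Vec m) (x : ℤ → Vec n) (u : ℤ → Vec m)
      (Δx : ℤ → Vec n) (Δu : ℤ → Vec m),
      (∀ k : ℤ, x k = (F k (fwdWin m R y k)).1) →
      (∀ k : ℤ, u k = (F k (fwdWin m R y k)).2) →
      (∀ k : ℤ, Δx k =
        fderiv ℝ (fun p => (F k p).1) (fwdWin m R y k) (fwdWin m R Δy k)) →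
      (∀ k : ℤ, Δu k =
        fderiv ℝ (fun p => (F k p).2) (fwdWin m R y k) (fwdWin m R Δy k)) →
      ∀ k : ℤ, Δx (k + 1) =
        fderiv ℝ (fun x' => f k x' (u k)) (x k) (Δx k) +
        fderiv ℝ (fun u' => f k (x k) u') (u k) (Δu k) := by
  intro y Δy x u Δx Δu hx hu hΔx hΔu k
  have hd (j : ℤ) : Differentiable ℝ (F j) := (hF.1 j).differentiable (by simp)
  have hfd : DifferentiableAt ℝ (Function.uncurry (f k)) (x k, u k) :=
    (hf k).differentiable (by simp) _
  have hline (j : ℤ) :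
      HasLineDerivAt ℝ (F j) (fderiv ℝ (F j) (fwdWin m R y j) (fwdWin m R Δy j))
        (fwdWin m R y j) (fwdWin m R Δy j) :=
    (hd j _).hasFDerivAt.hasLineDerivAt _
  have hpair (j : ℤ) :
      fderiv ℝ (F j) (fwdWin m R y j) (fwdWin m R Δy j) = (Δx j, Δu j) := by
    rw [hΔx, hΔu, fderiv.fst (hd j _), fderiv.snd (hd j _)]
    rfl
  have hnext : HasDerivAt (fun t : ℝ => (F (k + 1) (fwdWin m R (y + t • Δy) (k + 1))).1)
      (Δx (k + 1)) 0 := by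
    have h := hline (k + 1)
    rw [hpair] at h
    exact HasFDerivAt.comp_hasDerivAt (0 : ℝ) hasFDerivAt_fst h
  have hcur : HasDerivAt (fun t : ℝ => F k (fwdWin m R (y + t • Δy) k)) (Δx k, Δu k) 0 := by
    have h := hline k
    rwa [hpair] at h
  have hbase : F k (fwdWin m R (y + (0 : ℝ) • Δy) k) = (x k, u k) := by
    rw [zero_smul, add_zero, hx, hu]
  have hstep := HasFDerivAt.comp_hasDerivAt (0 : ℝ) (hbase ▸ hfd.hasFDerivAt) hcur
  rw [hbase, fderiv_uncurry_apply hfd] at hstep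
  exact hnext.unique (hstep.congr_of_eventuallyEq
    (Filter.Eventually.of_forall fun t => hF.2 (y + t • Δy) k))

end
end

section
/- The system f : ℤ × ℝ³ × ℝ² → ℝ³, f(k,(x¹,x²,x³),(u¹,u²)) := (−sin(x¹−x³) + u², (1 − sin(x¹−x³))u¹, u²), is not flat: for every trajectory (x̄,ū) of f along which f is submersive (equivalently, cos(x̄¹(k)−x̄³(k)) ≠ 0 and sin(x̄¹(k)−x̄³(k)) ≠ 1 for all k ∈ ℤ), the system f is not flat along (x̄,ū), i.e. there exist no window lengths q₁,q₂,r₁,r₂, open sets U, V, flat output Φ and parameterization F satisfying conditions (F1)–(F4). -/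
open Filter Topology

noncomputable section

/-- The system of the second example:
`x¹⁺ = -sin(x¹-x³) + u², x²⁺ = (1-sin(x¹-x³))u¹, x³⁺ = u²`. -/
def nonFlatSys : ℤ → Vec 3 → Vec 2 → Vec 3 :=
  fun _ x u =>
    ![-Real.sin (x 0 - x 2) + u 1, (1 - Real.sin (x 0 - x 2)) * u 0, u 1]

/-- The difference of the first and third coordinate, which evolves autonomously. -/
def autDiff (x : Vec 3) : ℝ := x 0 - x 2

lemma continuous_autDiff : Continuous autDiff := by
  unfold autDiff
  fun_prop

lemma autDiff_nonFlatSys (k : ℤ) (x : Vec 3) (u : Vec 2) :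
    autDiff (nonFlatSys k x u) = -Real.sin (autDiff x) := by
  simp [autDiff, nonFlatSys]

lemma abs_autDiff_nonFlatSys_lt (k : ℤ) (x : Vec 3) (u : Vec 2) :
    |autDiff (nonFlatSys k x u)| < Real.pi / 2 := by
  rw [autDiff_nonFlatSys, abs_neg]
  linarith [Real.abs_sin_le_one (autDiff x), Real.pi_gt_three]

lemma eq_of_sin_eq_of_abs_lt {a b : ℝ} (ha : |a| < Real.pi / 2) (hb : |b| < Real.pi / 2)
    (h : Real.sin a = Real.sin b) : a = b := by
  rw [abs_lt] at ha hb
  exact Real.injOn_sin ⟨ha.1.le, ha.2.le⟩ ⟨hb.1.le, hb.2.le⟩ h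

lemma abs_autDiff_lt_of_isTrajectory {x : ℤ → Vec 3} {u : ℤ → Vec 2}
    (h : IsTrajectory 3 2 nonFlatSys x u) (k : ℤ) : |autDiff (x k)| < Real.pi / 2 := by
  have hk := h (k - 1)
  rw [sub_add_cancel] at hk
  rw [hk]
  exact abs_autDiff_nonFlatSys_lt _ _ _

/-- The forward solution with initial state `x₀` at time `k₀` and input `u`. -/
def forwardState (u : ℤ → Vec 2) (k₀ : ℤ) (x₀ : Vec 3) : ℕ → Vec 3
  | 0 => x₀
  | n + 1 => nonFlatSys (k₀ + n) (forwardState u k₀ x₀ n) (u (k₀ + n))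

lemma continuous_forwardState (u : ℤ → Vec 2) (k₀ : ℤ) (n : ℕ) :
    Continuous fun x₀ => forwardState u k₀ x₀ n := by
  induction n with
  | zero => exact continuous_id
  | succ n ih =>
    have h : Continuous fun x : Vec 3 => nonFlatSys (k₀ + n) x (u (k₀ + n)) := by
      refine continuous_pi fun i => ?_
      fin_cases i <;> simp [nonFlatSys] <;> fun_prop
    exact h.comp ih

lemma forwardState_eq_of_isTrajectory {x : ℤ → Vec 3} {u : ℤ → Vec 2}
    (h : IsTrajectory 3 2 nonFlatSys x u) (k₀ : ℤ) (n : ℕ) :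
    forwardState u k₀ (x k₀) n = x (k₀ + n) := by
  induction n with
  | zero => simp [forwardState]
  | succ n ih =>
    rw [forwardState, ih, ← h]
    push_cast
    rw [add_assoc]

lemma abs_autDiff_forwardState_lt (u : ℤ → Vec 2) (k₀ : ℤ) {x₀ : Vec 3}
    (h : |autDiff x₀| < Real.pi / 2) (n : ℕ) :
    |autDiff (forwardState u k₀ x₀ n)| < Real.pi / 2 := by
  cases n with
  | zero => exact h
  | succ n => exact abs_autDiff_nonFlatSys_lt _ _ _

lemma autDiff_eq_of_forwardState (u : ℤ → Vec 2) (k₀ : ℤ) {x₀ x₁ : Vec 3}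
    (h₀ : |autDiff x₀| < Real.pi / 2) (h₁ : |autDiff x₁| < Real.pi / 2) (n : ℕ)
    (h : autDiff (forwardState u k₀ x₀ n) = autDiff (forwardState u k₀ x₁ n)) :
    autDiff x₀ = autDiff x₁ := by
  induction n with
  | zero => exact h
  | succ n ih =>
    rw [forwardState, forwardState, autDiff_nonFlatSys, autDiff_nonFlatSys] at h
    exact ih (eq_of_sin_eq_of_abs_lt (abs_autDiff_forwardState_lt u k₀ h₀ n)
      (abs_autDiff_forwardState_lt u k₀ h₁ n) (neg_injective h))

/-- The solution agreeing with `x` before `k₀` and restarted at `x₀` at time `k₀`. -/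
def restart (x : ℤ → Vec 3) (u : ℤ → Vec 2) (k₀ : ℤ) (x₀ : Vec 3) (i : ℤ) : Vec 3 :=
  if k₀ ≤ i then forwardState u k₀ x₀ (i - k₀).toNat else x i

lemma restart_self {x : ℤ → Vec 3} {u : ℤ → Vec 2}
    (h : IsTrajectory 3 2 nonFlatSys x u) (k₀ : ℤ) : restart x u k₀ (x k₀) = x := by
  funext i
  unfold restart
  split_ifs with hi
  · rw [forwardState_eq_of_isTrajectory h]
    congr 1
    omega
  · rfl

lemma continuous_restart (x : ℤ → Vec 3) (u : ℤ → Vec 2) (k₀ i : ℤ) :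
    Continuous fun x₀ => restart x u k₀ x₀ i := by
  unfold restart
  split_ifs
  · exact continuous_forwardState _ _ _
  · exact continuous_const

lemma restart_succ (x : ℤ → Vec 3) (u : ℤ → Vec 2) (k₀ : ℤ) (x₀ : Vec 3) {i : ℤ}
    (hi : k₀ ≤ i) :
    restart x u k₀ x₀ (i + 1) = nonFlatSys i (restart x u k₀ x₀ i) (u i) := by
  obtain ⟨n, rfl⟩ := Int.le.dest hi
  have h₁ : (k₀ + n + 1 - k₀).toNat = n + 1 := by omega
  have h₂ : (k₀ + n - k₀).toNat = n := by omega
  rw [restart, restart, if_pos (by omega), if_pos hi, h₁, h₂, forwardState]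

lemma dist_seqWin_lt {m r₁ r₂ : ℕ} {y z : ℤ → Vec m} {ε : ℝ} (hε : 0 < ε)
    (h : ∀ i, dist (y i) (z i) < ε) (k : ℤ) :
    dist (seqWin m r₁ r₂ y k) (seqWin m r₁ r₂ z k) < ε :=
  (dist_pi_lt_iff hε).2 fun _ => h _

namespace FlatData

variable {xb : ℤ → Vec 3} {ub : ℤ → Vec 2} {q₁ q₂ r₁ r₂ : ℕ}
  {U : Set (Fin (q₁ + q₂ + 1) → Vec 3 × Vec 2)} {V : Set (Fin (r₁ + r₂ + 1) → Vec 2)}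
  {Φ : ℤ → (Fin (q₁ + q₂ + 1) → Vec 3 × Vec 2) → Vec 2}
  {F : ℤ → (Fin (r₁ + r₂ + 1) → Vec 2) → Vec 3 × Vec 2}

lemma F_seqWin_refOut (D : FlatData 3 2 nonFlatSys xb ub q₁ q₂ r₁ r₂ U V Φ F) (k : ℤ) :
    F k (seqWin 2 r₁ r₂ (refOut 3 2 q₁ q₂ Φ xb ub) k) = (xb k, ub k) :=
  (D.F4 k xb ub (fun j _ _ => D.traj j) (fun j _ _ => D.memU j) (D.memV k)).symm

lemma exists_pos_mem_and_abs_lt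
    (D : FlatData 3 2 nonFlatSys xb ub q₁ q₂ r₁ r₂ U V Φ F) (k : ℤ) :
    ∃ ε > 0, ∀ y : ℤ → Vec 2, (∀ i, dist (y i) (refOut 3 2 q₁ q₂ Φ xb ub i) < ε) →
      seqWin 2 r₁ r₂ y k ∈ V ∧ |autDiff (F k (seqWin 2 r₁ r₂ y k)).1| < Real.pi / 2 := by
  set w := seqWin 2 r₁ r₂ (refOut 3 2 q₁ q₂ Φ xb ub) k with hw
  have hV : V ∈ 𝓝 w := D.openV.mem_nhds (D.memV k)
  have hF : ContinuousAt (F k) w := (D.smoothF k).continuousOn.continuousAt hV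
  have hc : ContinuousAt (fun v => |autDiff (F k v).1|) w :=
    (continuous_autDiff.comp continuous_fst).abs.continuousAt.comp hF
  have hlt : |autDiff (F k w).1| < Real.pi / 2 := by
    rw [hw, D.F_seqWin_refOut]
    exact abs_autDiff_lt_of_isTrajectory D.traj k
  obtain ⟨ε, hε, h⟩ := Metric.eventually_nhds_iff.1
    (Filter.Eventually.and hV (hc.eventually_lt_const hlt))
  exact ⟨ε, hε, fun y hy => h (dist_seqWin_lt hε hy k)⟩

lemma autDiff_F_succ (D : FlatData 3 2 nonFlatSys xb ub q₁ q₂ r₁ r₂ U V Φ F) {k : ℤ}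
    {y : ℤ → Vec 2} (h : seqWin 2 r₁ r₂ y k ∈ V) (h' : seqWin 2 r₁ r₂ y (k + 1) ∈ V) :
    autDiff (F (k + 1) (seqWin 2 r₁ r₂ y (k + 1))).1 =
      -Real.sin (autDiff (F k (seqWin 2 r₁ r₂ y k)).1) := by
  rw [D.F2 k y h h', autDiff_nonFlatSys]

/-- Near the reference, the autonomous coordinate does not depend on the first `j` entries of
the flat output window. -/
lemma exists_pos_autDiff_eq (D : FlatData 3 2 nonFlatSys xb ub q₁ q₂ r₁ r₂ U V Φ F)
    (j : ℕ) (k : ℤ) :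
    ∃ ε > 0, ∀ y z : ℤ → Vec 2, (∀ i, dist (y i) (refOut 3 2 q₁ q₂ Φ xb ub i) < ε) →
      (∀ i, dist (z i) (refOut 3 2 q₁ q₂ Φ xb ub i) < ε) →
      (∀ i, k - r₁ + j ≤ i → y i = z i) →
      autDiff (F k (seqWin 2 r₁ r₂ y k)).1 = autDiff (F k (seqWin 2 r₁ r₂ z k)).1 := by
  induction j generalizing k with
  | zero =>
    refine ⟨1, one_pos, fun y z _ _ h => ?_⟩
    have : seqWin 2 r₁ r₂ y k = seqWin 2 r₁ r₂ z k := by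
      funext i
      exact h _ (by push_cast; omega)
    rw [this]
  | succ j ih =>
    obtain ⟨ε, hε, h⟩ := ih (k + 1)
    obtain ⟨δ, hδ, h₀⟩ := D.exists_pos_mem_and_abs_lt k
    obtain ⟨δ', hδ', h₁⟩ := D.exists_pos_mem_and_abs_lt (k + 1)
    refine ⟨min ε (min δ δ'), by positivity, fun y z hy hz hyz => ?_⟩
    simp only [lt_min_iff] at hy hz
    obtain ⟨hyV, hy_abs⟩ := h₀ y fun i => (hy i).2.1
    obtain ⟨hzV, hz_abs⟩ := h₀ z fun i => (hz i).2.1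
    have heq := h y z (fun i => (hy i).1) (fun i => (hz i).1)
      fun i hi => hyz i (by push_cast; omega)
    rw [D.autDiff_F_succ hyV (h₁ y fun i => (hy i).2.2).1,
      D.autDiff_F_succ hzV (h₁ z fun i => (hz i).2.2).1] at heq
    exact eq_of_sin_eq_of_abs_lt hy_abs hz_abs (neg_injective heq)

/-- Near the reference window, the autonomous coordinate of the parameterization is constant. -/
lemma eventually_autDiff_eq (D : FlatData 3 2 nonFlatSys xb ub q₁ q₂ r₁ r₂ U V Φ F) (k : ℤ) :
    ∀ᶠ v in 𝓝 (seqWin 2 r₁ r₂ (refOut 3 2 q₁ q₂ Φ xb ub) k),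
      autDiff (F k v).1 = autDiff (xb k) := by
  obtain ⟨ε, hε, h⟩ := D.exists_pos_autDiff_eq (r₁ + r₂ + 1) k
  filter_upwards [Metric.ball_mem_nhds _ hε] with v hv
  rw [Metric.mem_ball, dist_pi_lt_iff hε] at hv
  set yb := refOut 3 2 q₁ q₂ Φ xb ub with hyb
  let y : ℤ → Vec 2 := fun i =>
    if hi : 0 ≤ i - (k - r₁) ∧ i - (k - r₁) < r₁ + r₂ + 1 then
      v ⟨(i - (k - r₁)).toNat, by omega⟩ else yb i
  have hyv : seqWin 2 r₁ r₂ y k = v := by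
    funext i
    have hi := i.isLt
    have hc : 0 ≤ k - r₁ + (i : ℕ) - (k - r₁) ∧
        k - r₁ + (i : ℕ) - (k - r₁) < r₁ + r₂ + 1 := by omega
    simp only [seqWin, y, dif_pos hc]
    congr 1
    ext
    simp
  have hy : ∀ i, dist (y i) (yb i) < ε := by
    intro i
    simp only [y]
    split_ifs with hi
    · convert hv ⟨(i - (k - r₁)).toNat, by omega⟩ using 2
      simp only [seqWin]
      congr 1
      omega
    · simpa using hε
  have heq := h y yb hy (by simpa using hε) fun i hi => by
    simp only [y]
    rw [dif_neg]
    push_cast at hi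
    omega
  rwa [hyv, hyb, D.F_seqWin_refOut] at heq

end FlatData

/-- The system `nonFlatSys` is not flat: along every
trajectory along which it is submersive, it is not flat. -/
theorem nonFlatSys_not_flat
    (xb : ℤ → Vec 3) (ub : ℤ → Vec 2)
    (htraj : IsTrajectory 3 2 nonFlatSys xb ub)
    (hsub : IsSubmersiveAlong 3 2 nonFlatSys xb ub) :
    ¬ IsFlatAlong 3 2 nonFlatSys xb ub := by
  rintro ⟨q₁, q₂, r₁, r₂, U, V, Φ, F, D⟩
  set k₀ : ℤ := 0 - r₁ - q₁ with hk₀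
  let x : ℝ → ℤ → Vec 3 := fun s => restart xb ub k₀ (xb k₀ + s • ![1, 0, 0])
  have hinit : Continuous fun s : ℝ => xb k₀ + s • (![1, 0, 0] : Vec 3) := by fun_prop
  have hzero : xb k₀ + (0 : ℝ) • (![1, 0, 0] : Vec 3) = xb k₀ := by rw [zero_smul, add_zero]
  have hx0 : x 0 = xb := by simp only [x, hzero, restart_self htraj]
  have hwin : ∀ j, Tendsto (fun s => pairWin 3 2 q₁ q₂ (x s) ub j) (𝓝 0)
      (𝓝 (pairWin 3 2 q₁ q₂ xb ub j)) := by
    intro j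
    have hc : Continuous fun s => pairWin 3 2 q₁ q₂ (x s) ub j :=
      continuous_pi fun i =>
        ((continuous_restart xb ub k₀ _).comp hinit).prodMk continuous_const
    simpa only [hx0] using hc.tendsto 0
  have hout : ∀ j, Tendsto (fun s => Φ j (pairWin 3 2 q₁ q₂ (x s) ub j)) (𝓝 0)
      (𝓝 (refOut 3 2 q₁ q₂ Φ xb ub j)) := fun j =>
    Tendsto.comp ((D.smoothPhi j).continuousOn.continuousAt (D.openU.mem_nhds (D.memU j)))
      (hwin j)
  have houtwin : Tendsto
      (fun s => seqWin 2 r₁ r₂ (fun j => Φ j (pairWin 3 2 q₁ q₂ (x s) ub j)) 0) (𝓝 0)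
      (𝓝 (seqWin 2 r₁ r₂ (refOut 3 2 q₁ q₂ Φ xb ub) 0)) :=
    tendsto_pi_nhds.2 fun i => hout _
  have hU : ∀ᶠ s in 𝓝 (0 : ℝ), ∀ j ∈ Finset.Icc (0 - r₁ : ℤ) (0 + r₂),
      pairWin 3 2 q₁ q₂ (x s) ub j ∈ U :=
    (Filter.eventually_all_finset _).2 fun j _ =>
      (hwin j).eventually (D.openU.mem_nhds (D.memU j))
  have hV := houtwin.eventually (D.openV.mem_nhds (D.memV 0))
  have hconst := houtwin.eventually (D.eventually_autDiff_eq 0)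
  have hb := abs_autDiff_lt_of_isTrajectory htraj k₀
  have hsmall : ∀ᶠ s in 𝓝 (0 : ℝ), |autDiff (xb k₀ + s • ![1, 0, 0])| < Real.pi / 2 :=
    (continuous_autDiff.comp hinit).abs.continuousAt.eventually_lt_const
      (by simpa only [Function.comp_apply, hzero] using hb)
  obtain ⟨s, ⟨⟨⟨hsU, hsV⟩, hs_const⟩, hs_small⟩, hs_ne⟩ :=
    (((((hU.and hV).and hconst).and hsmall).filter_mono nhdsWithin_le_nhds).and
      (self_mem_nhdsWithin (s := {0}ᶜ))).exists
  have hF4 := D.F4 0 (x s) ub (fun j hj _ => restart_succ xb ub k₀ _ hj)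
    (fun j h₁ h₂ => hsU j (Finset.mem_Icc.2 ⟨h₁, h₂⟩)) hsV
  rw [← hF4] at hs_const
  have hforward : autDiff (forwardState ub k₀ (xb k₀ + s • ![1, 0, 0]) (0 - k₀).toNat) =
      autDiff (forwardState ub k₀ (xb k₀) (0 - k₀).toNat) := by
    have h0 : k₀ ≤ 0 := by omega
    rw [← hx0] at hs_const
    simpa only [x, hzero, restart, if_pos h0] using hs_const
  have hdiff := autDiff_eq_of_forwardState ub k₀ hs_small hb _ hforward
  exact hs_ne (by simpa [autDiff] using hdiff)

end
end
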